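/- arXiv:1511.04580 — 13 statements merged into one kernel-verified Lean document; each statement's English description precedes it below -/
import Mathlib

section
/- Let n, m, k be positive integers and r a nonnegative integer with r < m and k ≤ min{n, m − r}, and let A = (A_1, …, A_n) be a family of subsets of [m]. Then the following are equivalent: (1) for every Y ⊆ [n] with |Y| ≤ k and every J ⊆ [m] with |J| ≥ m − r there exists an injective map f : Y → J with f(y) ∈ A_y for all y ∈ Y; (2) for every integer c with 1 ≤ c ≤ k and every c-element subset J' ⊆ [n], |⋃_{j∈J'} A_j| ≥ r + c. -/
/-- `A` is a combinatorial batch code with redundancy `r` (`t = 1`), in the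
Hall-type column characterization: every nonempty collection of at most `k`
columns spans at least `r + (number of columns)` rows. -/
def IsRCBC (r k : ℕ) {n m : ℕ} (A : Fin n → Finset (Fin m)) : Prop :=
  ∀ J : Finset (Fin n), 1 ≤ J.card → J.card ≤ k →
    r + J.card ≤ (J.biUnion A).card

/-- Hall's condition for restricted transversals: the columns in `Y` have distinct representatives
inside `J` as soon as each of their unions exceeds its size by at least `|Jᶜ|`. -/
theorem exists_injective_mem_of_card_compl_add_le {ι α : Type*} [Fintype α] [DecidableEq α]
    (A : ι → Finset α) (Y : Finset ι) (J : Finset α)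
    (h : ∀ s ⊆ Y, s.Nonempty → Jᶜ.card + s.card ≤ (s.biUnion A).card) :
    ∃ f : {y // y ∈ Y} → {x // x ∈ J}, Function.Injective f ∧ ∀ y, (f y : α) ∈ A y.1 := by
  obtain ⟨f, hf, hfA⟩ :=
    (Finset.all_card_le_biUnion_card_iff_exists_injective
      fun y : {y // y ∈ Y} => A y.1 ∩ J).1 fun s => by
    rcases s.eq_empty_or_nonempty with rfl | hs
    · simp
    · have hU : (s.map (Function.Embedding.subtype _)).biUnion A = s.biUnion fun y => A y.1 := by
        ext
        simp
      have hsY := h (s.map (Function.Embedding.subtype _))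
        (fun y hy => by
          obtain ⟨z, -, rfl⟩ := Finset.mem_map.1 hy
          exact z.2)
        hs.map
      rw [Finset.card_map, hU] at hsY
      have hle : (s.biUnion fun y => A y.1).card ≤
          ((s.biUnion fun y => A y.1 ∩ J) ∪ Jᶜ).card := by
        refine Finset.card_le_card fun x hx => ?_
        by_cases hxJ : x ∈ J <;> simp_all
      have hunion := Finset.card_union_le (s.biUnion fun y => A y.1 ∩ J) Jᶜ
      omega
  refine ⟨fun y => ⟨f y, (Finset.mem_inter.1 (hfA y)).2⟩, fun a b hab => ?_,
    fun y => (Finset.mem_inter.1 (hfA y)).1⟩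
  exact hf (congrArg Subtype.val hab)

/-- Distinct representatives avoiding `R` bound the number of columns by the number of elements of
their union outside `R`. -/
theorem card_le_card_biUnion_sdiff_of_injective {ι α : Type*} [Fintype α] [DecidableEq α]
    (A : ι → Finset α) (Y : Finset ι) (R : Finset α) (f : {y // y ∈ Y} → {x // x ∈ Rᶜ})
    (hf : Function.Injective f) (hfA : ∀ y, (f y : α) ∈ A y.1) :
    Y.card ≤ (Y.biUnion A \ R).card := by
  rw [← Finset.card_attach]
  refine Finset.card_le_card_of_injOn (fun y => (f y : α)) (fun y _ => ?_)
    (Subtype.val_injective.comp hf).injOn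
  exact Finset.mem_sdiff.2
    ⟨Finset.mem_biUnion.2 ⟨y.1, y.2, hfA y⟩, Finset.mem_compl.1 (f y).2⟩

/-- the retrieval definition of an `r`-CBC (with `t = 1`) is
equivalent to the Hall-type column condition. -/
theorem rcbc_retrieval_iff_hall (n m k r : ℕ) (hn : 0 < n) (hm : 0 < m)
    (hk : 0 < k) (hrm : r < m) (hkmin : k ≤ min n (m - r))
    (A : Fin n → Finset (Fin m)) :
    (∀ Y : Finset (Fin n), Y.card ≤ k →
      ∀ J : Finset (Fin m), m - r ≤ J.card →
        ∃ f : {y : Fin n // y ∈ Y} → {x : Fin m // x ∈ J},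
          Function.Injective f ∧ ∀ y, (f y : Fin m) ∈ A y.1) ↔
      IsRCBC r k A := by
  constructor
  · intro h Y hY hYk
    obtain ⟨R, hRU, hR⟩ :=
      Finset.exists_subset_card_eq (min_le_right r (Y.biUnion A).card)
    have hRc : m - r ≤ Rᶜ.card := by
      rw [Finset.card_compl, Fintype.card_fin]
      omega
    obtain ⟨f, hf, hfA⟩ := h Y hYk Rᶜ hRc
    have hle := card_le_card_biUnion_sdiff_of_injective A Y R f hf hfA
    rw [Finset.card_sdiff_of_subset hRU] at hle
    omega
  · intro h Y hYk J hJ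
    refine exists_injective_mem_of_card_compl_add_le A Y J fun s hsY hs => ?_
    have hsA := h s hs.card_pos ((Finset.card_le_card hsY).trans hYk)
    rw [Finset.card_compl, Fintype.card_fin]
    omega
end

section
/- Let n, m, k be positive integers and r a nonnegative integer with r < m and k ≤ min{n, m − r}, and let A = (A_1, …, A_n) be a family of subsets of [m]. Then the following are equivalent: (1) for every integer c with 1 ≤ c ≤ k and every c-element subset J ⊆ [n], |⋃_{j∈J} A_j| ≥ r + c; (2) for every subset I ⊆ [m] with r ≤ |I| ≤ r + k − 1, the number of indices j ∈ [n] with A_j ⊆ I is at most |I| − r. -/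
/-- the Hall-type column condition is equivalent to the row
condition: every set `I` of rows with `r ≤ |I| ≤ r + k - 1` contains at most
`|I| - r` columns. -/
theorem rcbc_hall_iff_rows (n m k r : ℕ) (hn : 0 < n) (hm : 0 < m)
    (hk : 0 < k) (hrm : r < m) (hkmin : k ≤ min n (m - r))
    (A : Fin n → Finset (Fin m)) :
    IsRCBC r k A ↔
      (∀ I : Finset (Fin m), r ≤ I.card → I.card ≤ r + k - 1 →
        (Finset.univ.filter fun j => A j ⊆ I).card ≤ I.card - r) := by
  constructor
  · intro h I hI hIk
    by_contra! hlt
    obtain ⟨J, hJ, hJc⟩ := Finset.exists_subset_card_eq (Nat.succ_le_of_lt hlt)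
    have hsub : J.biUnion A ⊆ I :=
      Finset.biUnion_subset.mpr fun j hj => (Finset.mem_filter.mp (hJ hj)).2
    have hle := Finset.card_le_card hsub
    have hall := h J (by omega) (by omega)
    omega
  · intro h J hJ hJk
    by_contra! hlt
    obtain ⟨I, hUI, hIc⟩ := Finset.exists_superset_card_eq
      (s := J.biUnion A) (n := r + J.card - 1) (by omega)
      (by rw [Fintype.card_fin]; omega)
    have hsub : J ⊆ Finset.univ.filter fun j => A j ⊆ I := fun j hj =>
      Finset.mem_filter.mpr
        ⟨Finset.mem_univ j, (Finset.subset_biUnion_of_mem A hj).trans hUI⟩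
    have hle := Finset.card_le_card hsub
    have hrows := h I (by omega) (by omega)
    omega
end

section
/- Let n, m, k be positive integers and r a nonnegative integer, and let A = (A_1, …, A_n) be an r-CBC(n,k,m) with some column satisfying |A_{j_0}| > r + k. Then A is not optimal: there exists an r-CBC(n,k,m) A' with N(A') < N(A). Consequently, every r-CBC(n,k,m) of minimum weight has all columns of cardinality at most r + k. -/
/-- The weight `N(A)` of a family of columns. -/
def weight {n m : ℕ} (A : Fin n → Finset (Fin m)) : ℕ := ∑ j, (A j).card

/-- `N(n,k,m;r)`: the minimum weight of an `r`-CBC(n,k,m). -/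
noncomputable def minWeight (n k m r : ℕ) : ℕ :=
  sInf {w | ∃ A : Fin n → Finset (Fin m), IsRCBC r k A ∧ weight A = w}

/-- Shrinking a column of cardinality greater than `r + k` to one of cardinality `r + k`
preserves the code property and lowers the weight. -/
theorem IsRCBC.exists_weight_lt {n m k r : ℕ} {A : Fin n → Finset (Fin m)}
    (hA : IsRCBC r k A) {j₀ : Fin n} (hj₀ : r + k < (A j₀).card) :
    ∃ A' : Fin n → Finset (Fin m), IsRCBC r k A' ∧ weight A' < weight A := by
  obtain ⟨S, hS, hcard⟩ := Finset.exists_subset_card_eq hj₀.le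
  refine ⟨Function.update A j₀ S, fun J h1 h2 => ?_, ?_⟩
  · by_cases hj : j₀ ∈ J
    · have hsub := Finset.card_le_card
        (Finset.subset_biUnion_of_mem (Function.update A j₀ S) hj)
      rw [Function.update_self] at hsub
      omega
    · have hU : J.biUnion (Function.update A j₀ S) = J.biUnion A :=
        Finset.biUnion_congr rfl fun j hjJ =>
          Function.update_of_ne (ne_of_mem_of_not_mem hjJ hj) _ _
      rw [hU]
      exact hA J h1 h2
  · refine Finset.sum_lt_sum (fun j _ => ?_) ⟨j₀, Finset.mem_univ _, ?_⟩
    · rcases eq_or_ne j j₀ with rfl | hj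
      · rw [Function.update_self]
        exact Finset.card_le_card hS
      · rw [Function.update_of_ne hj]
    · rwa [Function.update_self, hcard]

/-- an `r`-CBC with a column of cardinality greater than `r + k`
is not optimal; consequently every minimum-weight `r`-CBC has all columns of
cardinality at most `r + k`. -/
theorem rcbc_col_card_upper (n m k r : ℕ) (hn : 0 < n) (hm : 0 < m)
    (hk : 0 < k) (A : Fin n → Finset (Fin m)) (hA : IsRCBC r k A)
    (j₀ : Fin n) (hj₀ : r + k < (A j₀).card) :
    (∃ A' : Fin n → Finset (Fin m), IsRCBC r k A' ∧ weight A' < weight A) ∧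
      (∀ B : Fin n → Finset (Fin m), IsRCBC r k B →
        weight B = minWeight n k m r → ∀ j : Fin n, (B j).card ≤ r + k) := by
  refine ⟨hA.exists_weight_lt hj₀, fun B hB hw j => ?_⟩
  by_contra! hj
  obtain ⟨B', hB', hlt⟩ := hB.exists_weight_lt hj
  have hmin : minWeight n k m r ≤ weight B' := Nat.sInf_le ⟨B', hB', rfl⟩
  omega
end

section
/- Let n, m, k be positive integers and r a nonnegative integer with k ≤ n ≤ m and k ≤ m − r. Then N(n,k,m;r) = (r + 1)n. -/
/-- The cyclic interval `{a, a + 1, …, a + s}` in `Fin m`. -/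
def cyclicInterval {m : ℕ} [NeZero m] (s : ℕ) (a : Fin m) : Finset (Fin m) :=
  (Finset.range (s + 1)).image fun i => a + Fin.ofNat m i

theorem mem_cyclicInterval {m : ℕ} [NeZero m] {s : ℕ} {a b : Fin m} :
    b ∈ cyclicInterval s a ↔ ∃ i ≤ s, a + Fin.ofNat m i = b := by
  simp [cyclicInterval]

theorem card_cyclicInterval_le {m : ℕ} [NeZero m] (s : ℕ) (a : Fin m) :
    (cyclicInterval s a).card ≤ s + 1 :=
  Finset.card_image_le.trans_eq (Finset.card_range _)

theorem add_ofNat_succ {m : ℕ} [NeZero m] (a : Fin m) (i : ℕ) :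
    a + Fin.ofNat m (i + 1) = a + Fin.ofNat m i + Fin.ofNat m 1 := by
  apply Fin.ext
  simp [Fin.val_add, Nat.add_mod, add_assoc]

theorem eq_univ_of_forall_add_one_mem {m : ℕ} [NeZero m] {S : Finset (Fin m)}
    (hS : S.Nonempty) (h : ∀ a ∈ S, a + Fin.ofNat m 1 ∈ S) : S = Finset.univ := by
  obtain ⟨a, ha⟩ := hS
  have step (i : ℕ) : a + Fin.ofNat m i ∈ S := by
    induction i with
    | zero => simpa using ha
    | succ i ih => rw [add_ofNat_succ]; exact h _ ih
  refine Finset.eq_univ_iff_forall.2 fun b => ?_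
  simpa using step (b - a).val

theorem min_le_card_biUnion_cyclicInterval {m : ℕ} [NeZero m] {J : Finset (Fin m)}
    (hJ : J.Nonempty) (s : ℕ) : min m (s + J.card) ≤ (J.biUnion (cyclicInterval s)).card := by
  have subset (s : ℕ) : J ⊆ J.biUnion (cyclicInterval s) := fun a ha =>
    Finset.mem_biUnion.2 ⟨a, ha, mem_cyclicInterval.2 ⟨0, s.zero_le, by simp⟩⟩
  induction s with
  | zero => exact (min_le_right _ _).trans (by simpa using Finset.card_le_card (subset 0))
  | succ s ih =>
    have mono : J.biUnion (cyclicInterval s) ⊆ J.biUnion (cyclicInterval (s + 1)) :=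
      Finset.biUnion_mono fun a _ b hb => by
        obtain ⟨i, hi, h⟩ := mem_cyclicInterval.1 hb
        exact mem_cyclicInterval.2 ⟨i, by omega, h⟩
    by_cases heq : J.biUnion (cyclicInterval s) = J.biUnion (cyclicInterval (s + 1))
    · have huniv : J.biUnion (cyclicInterval s) = Finset.univ := by
        refine eq_univ_of_forall_add_one_mem (hJ.mono (subset s)) fun b hb => ?_
        rw [heq]
        obtain ⟨a, ha, hab⟩ := Finset.mem_biUnion.1 hb
        obtain ⟨i, hi, rfl⟩ := mem_cyclicInterval.1 hab
        exact Finset.mem_biUnion.2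
          ⟨a, ha, mem_cyclicInterval.2 ⟨i + 1, by omega, add_ofNat_succ a i⟩⟩
      simp [← heq, huniv]
    · have := Finset.card_lt_card (mono.ssubset_of_ne heq)
      omega

theorem isRCBC_cyclicInterval {n m k r : ℕ} [NeZero m] (hnm : n ≤ m) (hkmr : r + k ≤ m) :
    IsRCBC r k fun j : Fin n => cyclicInterval r (Fin.castLE hnm j) := by
  intro J hJ hJk
  have h := min_le_card_biUnion_cyclicInterval
    ((Finset.card_pos.1 hJ).map (f := Fin.castLEEmb hnm)) r
  rw [Finset.card_map, Finset.map_eq_image, Finset.image_biUnion, min_eq_right (by omega)] at h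
  exact h

theorem IsRCBC.le_weight {n m k r : ℕ} {A : Fin n → Finset (Fin m)} (hA : IsRCBC r k A)
    (hk : 0 < k) : (r + 1) * n ≤ weight A := by
  have h (j : Fin n) : r + 1 ≤ (A j).card := by
    simpa using hA {j} (by simp) (by rwa [Finset.card_singleton])
  simpa [weight, mul_comm] using Finset.sum_le_sum fun j (_ : j ∈ Finset.univ) => h j

theorem weight_cyclicInterval_le {n m : ℕ} [NeZero m] (r : ℕ) (f : Fin n → Fin m) :
    weight (fun j => cyclicInterval r (f j)) ≤ (r + 1) * n := by
  simpa [weight, mul_comm] using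
    Finset.sum_le_sum fun j (_ : j ∈ Finset.univ) => card_cyclicInterval_le r (f j)

/-- Theorem `thm:tall`: if `k ≤ n ≤ m` and `k ≤ m - r`, then
`N(n,k,m;r) = (r+1)n`. -/
theorem minWeight_tall (n m k r : ℕ) (hk : 0 < k) (hkn : k ≤ n) (hnm : n ≤ m)
    (hkmr : k ≤ m - r) :
    minWeight n k m r = (r + 1) * n := by
  have : NeZero m := ⟨by omega⟩
  have hA := isRCBC_cyclicInterval hnm (show r + k ≤ m by omega)
  have hw := (weight_cyclicInterval_le r (Fin.castLE hnm)).antisymm (hA.le_weight hk)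
  refine IsLeast.csInf_eq ⟨⟨_, hA, hw⟩, ?_⟩
  rintro w ⟨B, hB, rfl⟩
  exact hB.le_weight hk
end

section
/- Let A = (A_1, …, A_n) be an r-CBC(n,k,m), and suppose there are indices i, j ∈ [n] with A_i ⊊ A_j. Let R be a nonempty set with R ⊆ A_j \ A_i. Then the family A' obtained from A by replacing A_i with A_i ∪ R and A_j with A_j \ R is again an r-CBC(n,k,m), and N(A') = N(A). -/
/-- A family all of whose columns over `J` cover the columns of `A` over some `J'` of the same size
inherits the bound on `J`. -/
theorem IsRCBC.le_card_biUnion_of_subset {r k n m : ℕ} {A B : Fin n → Finset (Fin m)}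
    (hA : IsRCBC r k A) {J J' : Finset (Fin n)} (hcard : J'.card = J.card) (h1 : 1 ≤ J.card)
    (hk : J.card ≤ k) (hsub : J'.biUnion A ⊆ J.biUnion B) :
    r + J.card ≤ (J.biUnion B).card :=
  hcard ▸ (hA J' (hcard ▸ h1) (hcard ▸ hk)).trans (Finset.card_le_card hsub)

/-- Lemma `lem:move_ones`: moving a nonempty set
`R ⊆ A j \ A i` of ones from column `j` to column `i`, where `A i ⊊ A j`,
preserves the `r`-CBC property and the weight. -/
theorem rcbc_move_ones (n m k r : ℕ) (A : Fin n → Finset (Fin m))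
    (hA : IsRCBC r k A) (i j : Fin n) (hij : A i ⊂ A j)
    (R : Finset (Fin m)) (hR : R.Nonempty) (hRsub : R ⊆ A j \ A i) :
    IsRCBC r k (Function.update (Function.update A i (A i ∪ R)) j (A j \ R)) ∧
      weight (Function.update (Function.update A i (A i ∪ R)) j (A j \ R)) =
        weight A := by
  have hne : i ≠ j := by
    rintro rfl
    exact hij.ne rfl
  have hRj : R ⊆ A j := hRsub.trans Finset.sdiff_subset
  have hRi : Disjoint (A i) R := (Finset.subset_sdiff.mp hRsub).2.symm
  set B := Function.update (Function.update A i (A i ∪ R)) j (A j \ R) with hB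
  have hBj : B j = A j \ R := by simp [hB]
  have hBi : B i = A i ∪ R := by simp [hB, hne]
  have hBx : ∀ x, x ≠ i → x ≠ j → B x = A x := fun x hxi hxj => by simp [hB, hxi, hxj]
  have hsubB : ∀ x, x ≠ j → A x ⊆ B x := by
    intro x hxj
    by_cases hxi : x = i
    · rw [hxi, hBi]
      exact Finset.subset_union_left
    · rw [hBx x hxi hxj]
  refine ⟨fun J h1 hk => ?_, ?_⟩
  · by_cases hj : j ∈ J
    · by_cases hi : i ∈ J
      · refine hA.le_card_biUnion_of_subset rfl h1 hk (Finset.biUnion_subset.mpr fun x hx => ?_)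
        by_cases hxj : x = j
        · intro a ha
          rw [Finset.mem_biUnion]
          by_cases haR : a ∈ R
          · exact ⟨i, hi, hBi ▸ Finset.mem_union_right _ haR⟩
          · exact ⟨j, hj, hBj ▸ Finset.mem_sdiff.mpr ⟨hxj ▸ ha, haR⟩⟩
        · exact (hsubB x hxj).trans (Finset.subset_biUnion_of_mem B hx)
      · have hcard : (insert i (J.erase j)).card = J.card := by
          rw [Finset.card_insert_of_notMem (fun h => hi (Finset.mem_of_mem_erase h)),
            Finset.card_erase_add_one hj]
        refine hA.le_card_biUnion_of_subset hcard h1 hk (Finset.biUnion_subset.mpr fun x hx => ?_)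
        rcases Finset.mem_insert.mp hx with rfl | hx
        · refine Finset.Subset.trans ?_ (Finset.subset_biUnion_of_mem B hj)
          rw [hBj]
          exact Finset.subset_sdiff.mpr ⟨hij.subset, hRi⟩
        · exact (hsubB x (Finset.ne_of_mem_erase hx)).trans
            (Finset.subset_biUnion_of_mem B (Finset.mem_of_mem_erase hx))
    · exact hA.le_card_biUnion_of_subset rfl h1 hk
        (Finset.biUnion_mono fun x hx => hsubB x fun h => hj (h ▸ hx))
  · have hpair : (B i).card + (B j).card = (A i).card + (A j).card := by
      rw [hBi, hBj, Finset.card_union_of_disjoint hRi, add_assoc, add_comm R.card,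
        Finset.card_sdiff_add_card_eq_card hRj]
    have hmem : i ∈ Finset.univ.erase j := by simp [hne]
    have hrest : ∑ x ∈ (Finset.univ.erase j).erase i, (B x).card =
        ∑ x ∈ (Finset.univ.erase j).erase i, (A x).card :=
      Finset.sum_congr rfl fun x hx => by
        rw [hBx x (Finset.ne_of_mem_erase hx)
          (Finset.ne_of_mem_erase (Finset.mem_of_mem_erase hx))]
    simp only [weight]
    rw [← Finset.add_sum_erase _ _ (Finset.mem_univ j), ← Finset.add_sum_erase _ _ hmem,
      ← Finset.add_sum_erase _ (fun x => (A x).card) (Finset.mem_univ j),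
      ← Finset.add_sum_erase _ (fun x => (A x).card) hmem, hrest]
    omega
end

section
/- Let n, m, k be positive integers and r a nonnegative integer with r < m and k ≤ min{n, m − r}. Then there exists an r-CBC(n,k,m) A' of minimum weight (N(A') = N(n,k,m;r)) such that either (i) r + 1 ≤ |A'_j| ≤ r + k − 1 for every j ∈ [n], or (ii) r + k − 1 ≤ |A'_j| ≤ r + k for every j ∈ [n]. -/
section RCBC

variable {n m r k : ℕ} {A : Fin n → Finset (Fin m)}

open Function

theorem minWeight_le (hA : IsRCBC r k A) : minWeight n k m r ≤ weight A :=
  Nat.sInf_le ⟨A, hA, rfl⟩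

theorem weight_update_add (A : Fin n → Finset (Fin m)) (j : Fin n) (B : Finset (Fin m)) :
    weight (update A j B) + (A j).card = weight A + B.card := by
  have hA := Finset.add_sum_erase Finset.univ (fun i => (A i).card) (Finset.mem_univ j)
  have hB := Finset.add_sum_erase Finset.univ (fun i => (update A j B i).card) (Finset.mem_univ j)
  have hAB : ∑ i ∈ Finset.univ.erase j, (update A j B i).card =
      ∑ i ∈ Finset.univ.erase j, (A i).card :=
    Finset.sum_congr rfl fun i hi => by rw [update_of_ne (Finset.ne_of_mem_erase hi)]
  simp only [update_self] at hB
  unfold weight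
  omega

theorem exists_isRCBC_weight_eq_minWeight (hm : r + k ≤ m) :
    ∃ A : Fin n → Finset (Fin m), IsRCBC r k A ∧ weight A = minWeight n k m r := by
  refine Nat.sInf_mem (s := {w | ∃ A : Fin n → Finset (Fin m), IsRCBC r k A ∧ weight A = w})
    ⟨_, fun _ => Finset.univ, fun J hJ hJk => ?_, rfl⟩
  obtain ⟨j, hj⟩ := Finset.card_pos.mp hJ
  have := Finset.card_le_card (Finset.subset_biUnion_of_mem (fun _ => Finset.univ) hj :
    (Finset.univ : Finset (Fin m)) ⊆ _)
  rw [Finset.card_fin] at this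
  omega

theorem IsRCBC.add_one_le_card (hA : IsRCBC r k A) (hk : 0 < k) (j : Fin n) :
    r + 1 ≤ (A j).card := by
  simpa using hA {j} (by simp) (by rw [Finset.card_singleton]; exact hk)

/-- A column with at least `r + k` elements satisfies every condition it takes part in. -/
theorem IsRCBC.update_of_le_card (hA : IsRCBC r k A) (j : Fin n) {B : Finset (Fin m)}
    (hB : r + k ≤ B.card) : IsRCBC r k (update A j B) := by
  intro J hJ hJk
  by_cases hj : j ∈ J
  · have := Finset.card_le_card (Finset.subset_biUnion_of_mem (update A j B) hj)
    rw [update_self] at this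
    omega
  · rw [Finset.biUnion_congr rfl fun i hi => update_of_ne (ne_of_mem_of_not_mem hi hj) B A]
    exact hA J hJ hJk

theorem IsRCBC.card_le_of_weight_eq_minWeight (hA : IsRCBC r k A)
    (hw : weight A = minWeight n k m r) (j : Fin n) : (A j).card ≤ r + k := by
  by_contra! h
  obtain ⟨B, -, hB⟩ := Finset.exists_subset_card_eq h.le
  have := minWeight_le (hA.update_of_le_card j hB.ge)
  have := weight_update_add A j B
  omega

/-- Replacing column `i` by an `(r + k - 1)`-set `B` containing column `l`, while adding to
column `l` an element outside `B`, preserves the code property. -/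
theorem IsRCBC.update_insert (hA : IsRCBC r k A) {i l : Fin n} (hil : i ≠ l)
    {B : Finset (Fin m)} (hlB : A l ⊆ B) (hB : B.card = r + k - 1) {x : Fin m} (hx : x ∉ B) :
    IsRCBC r k (update (update A i B) l (insert x (A l))) := by
  set A' := update (update A i B) l (insert x (A l)) with hA'
  have hA'l : A' l = insert x (A l) := by simp [hA']
  have hA'i : A' i = B := by simp [hA', hil]
  have hle : ∀ j, j ≠ i → A j ⊆ A' j := by
    intro j hji
    by_cases hjl : j = l
    · subst hjl
      rw [hA'l]
      exact Finset.subset_insert _ _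
    · simp [hA', hjl, hji]
  intro J hJ hJk
  by_cases hi : i ∈ J
  · have hBJ : B ⊆ J.biUnion A' := hA'i ▸ Finset.subset_biUnion_of_mem A' hi
    rcases hJk.lt_or_eq with hlt | heq
    · have := Finset.card_le_card hBJ
      omega
    by_cases hl : l ∈ J
    · have hxJ : x ∈ J.biUnion A' :=
        Finset.mem_biUnion.mpr ⟨l, hl, hA'l ▸ Finset.mem_insert_self _ _⟩
      have := Finset.card_le_card (Finset.insert_subset hxJ hBJ)
      rw [Finset.card_insert_of_notMem hx] at this
      omega
    · have hcard : (insert l (J.erase i)).card = J.card := by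
        rw [Finset.card_insert_of_notMem fun h => hl (Finset.mem_of_mem_erase h),
          Finset.card_erase_add_one hi]
      calc r + J.card ≤ ((insert l (J.erase i)).biUnion A).card :=
            hcard ▸ hA _ (hcard ▸ hJ) (hcard ▸ hJk)
        _ ≤ (J.biUnion A').card := by
            refine Finset.card_le_card ?_
            rw [Finset.biUnion_insert]
            refine Finset.union_subset (hlB.trans hBJ) (Finset.biUnion_subset.mpr fun j hj => ?_)
            exact (hle j (Finset.ne_of_mem_erase hj)).trans
              (Finset.subset_biUnion_of_mem A' (Finset.mem_of_mem_erase hj))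
  · exact (hA J hJ hJk).trans (Finset.card_le_card (Finset.biUnion_mono fun j hj =>
      hle j (ne_of_mem_of_not_mem hj hi)))

theorem IsRCBC.exists_card_filter_lt (hA : IsRCBC r k A) (hm : r + k ≤ m) {i l : Fin n}
    (hi : (A i).card = r + k) (hl : (A l).card < r + k - 1) :
    ∃ A' : Fin n → Finset (Fin m), IsRCBC r k A' ∧ weight A' = weight A ∧
      (Finset.univ.filter fun j => (A' j).card = r + k).card <
        (Finset.univ.filter fun j => (A j).card = r + k).card := by
  have hil : i ≠ l := by
    rintro rfl
    omega
  obtain ⟨B, hlB, -, hB⟩ := Finset.exists_subsuperset_card_eq (Finset.subset_univ (A l)) hl.le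
    (by rw [Finset.card_fin]; omega)
  obtain ⟨x, hx⟩ : ∃ x, x ∉ B := by
    by_contra! h
    rw [Finset.eq_univ_of_forall h, Finset.card_fin] at hB
    omega
  have hxl := Finset.card_insert_of_notMem fun h => hx (hlB h)
  refine ⟨_, hA.update_insert hil hlB hB hx, ?_, Finset.card_lt_card ?_⟩
  · have h₁ := weight_update_add A i B
    have h₂ := weight_update_add (update A i B) l (insert x (A l))
    rw [update_of_ne hil.symm] at h₂
    omega
  · refine (Finset.ssubset_iff_of_subset fun j hj => ?_).mpr ⟨i, by simpa using hi, ?_⟩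
    · simp only [Finset.mem_filter, Finset.mem_univ, true_and] at hj ⊢
      rcases eq_or_ne j l with rfl | hjl
      · rw [update_self] at hj
        omega
      rw [update_of_ne hjl] at hj
      rcases eq_or_ne j i with rfl | hji
      · exact hi
      · rwa [update_of_ne hji] at hj
    · simp only [Finset.mem_filter, Finset.mem_univ, true_and, update_of_ne hil, update_self]
      omega

end RCBC

/-- Lemma `lem:types`: there is an optimal `r`-CBC(n,k,m) whose
column cardinalities all lie in `[r+1, r+k-1]` or all lie in `[r+k-1, r+k]`. -/
theorem exists_optimal_rcbc_of_type (n m k r : ℕ) (hn : 0 < n) (hm : 0 < m)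
    (hk : 0 < k) (hrm : r < m) (hkmin : k ≤ min n (m - r)) :
    ∃ A' : Fin n → Finset (Fin m), IsRCBC r k A' ∧
      weight A' = minWeight n k m r ∧
      ((∀ j : Fin n, r + 1 ≤ (A' j).card ∧ (A' j).card ≤ r + k - 1) ∨
        (∀ j : Fin n, r + k - 1 ≤ (A' j).card ∧ (A' j).card ≤ r + k)) := by
  have hrk : r + k ≤ m := by omega
  obtain ⟨A, ⟨hA, hw⟩, hmin⟩ := Set.exists_min_image
    {A : Fin n → Finset (Fin m) | IsRCBC r k A ∧ weight A = minWeight n k m r}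
    (fun A => (Finset.univ.filter fun j => (A j).card = r + k).card) (Set.toFinite _)
    (exists_isRCBC_weight_eq_minWeight hrk)
  refine ⟨A, hA, hw, ?_⟩
  have hlow := hA.add_one_le_card hk
  have hupp := hA.card_le_of_weight_eq_minWeight hw
  by_cases hfull : ∃ i, (A i).card = r + k
  · obtain ⟨i, hi⟩ := hfull
    refine Or.inr fun l => ⟨?_, hupp l⟩
    by_contra! hl
    obtain ⟨A', hA', hw', hlt⟩ := hA.exists_card_filter_lt hrk hi hl
    exact (hmin A' ⟨hA', hw'.trans hw⟩).not_gt hlt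
  · push Not at hfull
    refine Or.inl fun j => ⟨hlow j, ?_⟩
    have := hupp j
    have := hfull j
    omega
end

section
/- Let n, m, k be positive integers and r a nonnegative integer with k ≤ m − r and n ≥ (k − 1)·C(m, r + k − 1), where C denotes the binomial coefficient. Then N(n,k,m;r) = (r + k)n − (k − 1)·C(m, r + k − 1). -/
open Finset in
/-- A set has at least `t + 1 - #s` supersets of size `t`, if `t` is less than the size of the
ground set. -/
theorem add_one_sub_card_le_card_supersets {m t : ℕ} (ht : t < m) (s : Finset (Fin m)) :
    t + 1 - s.card ≤ ((powersetCard t univ).filter (s ⊆ ·)).card := by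
  by_cases hs : s.card ≤ t
  · obtain ⟨b, hsb, hb⟩ := exists_superset_card_eq (s := s) (n := t + 1) (by omega)
      (by simpa using ht)
    rw [← hb, ← card_sdiff_of_subset hsb]
    refine card_le_card_of_injOn (fun x => b.erase x) ?_ ?_
    · intro x hx
      obtain ⟨hxb, hxs⟩ := mem_sdiff.1 hx
      simp only [coe_filter, mem_powersetCard, subset_univ, true_and, Set.mem_ofPred_eq]
      exact ⟨by rw [card_erase_of_mem hxb, hb]; rfl, subset_erase.2 ⟨hsb, hxs⟩⟩
    · intro x hx y _ hxy
      exact (erase_inj b (mem_sdiff.1 hx).1).1 hxy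
  · omega

open Finset in
/-- A set of size `r + p` contains at most `p` columns of a code that retrieves `p + 1` items. -/
theorem IsRCBC.card_filter_subset_le {n m p r : ℕ} {A : Fin n → Finset (Fin m)}
    (hA : IsRCBC r (p + 1) A) {S : Finset (Fin m)} (hS : S.card = r + p) :
    (univ.filter (A · ⊆ S)).card ≤ p := by
  by_contra! h
  obtain ⟨J, hJ, hJc⟩ := exists_subset_card_eq (Nat.succ_le_of_lt h)
  have hunion := hA J (by omega) (by omega)
  have hsub : J.biUnion A ⊆ S := biUnion_subset.2 fun j hj => (mem_filter.1 (hJ hj)).2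
  have := card_le_card hsub
  omega

open Finset in
theorem IsRCBC.le_weight_add {n m p r : ℕ} (hm : r + p < m) {A : Fin n → Finset (Fin m)}
    (hA : IsRCBC r (p + 1) A) :
    n * (r + p + 1) ≤ weight A + p * m.choose (r + p) := by
  have hcount : ∑ j, (r + p + 1 - (A j).card) ≤ p * m.choose (r + p) :=
    calc ∑ j, (r + p + 1 - (A j).card)
        ≤ ∑ j, ((powersetCard (r + p) univ).filter (A j ⊆ ·)).card :=
          sum_le_sum fun j _ => add_one_sub_card_le_card_supersets hm (A j)
      _ = ∑ S ∈ powersetCard (r + p) univ, (univ.filter (A · ⊆ S)).card :=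
          sum_card_bipartiteAbove_eq_sum_card_bipartiteBelow (fun j S => A j ⊆ S)
      _ ≤ ∑ S ∈ powersetCard (r + p) (univ : Finset (Fin m)), p :=
          sum_le_sum fun S hS => hA.card_filter_subset_le (mem_powersetCard.1 hS).2
      _ = p * m.choose (r + p) := by simp [mul_comm]
  calc n * (r + p + 1) = ∑ _j : Fin n, (r + p + 1) := by simp
    _ ≤ ∑ j, ((A j).card + (r + p + 1 - (A j).card)) := sum_le_sum fun j _ => by omega
    _ ≤ weight A + p * m.choose (r + p) := by
      rw [sum_add_distrib]
      exact Nat.add_le_add_left hcount _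

open Finset in
/-- The optimal code: every set of size `r + p` is used `p` times, and all other columns have
size `r + p + 1`. -/
theorem exists_isRCBC_weight_add_eq {n m p r : ℕ} (hm : r + p < m)
    (hn : p * m.choose (r + p) ≤ n) :
    ∃ A : Fin n → Finset (Fin m), IsRCBC r (p + 1) A ∧
      weight A + p * m.choose (r + p) = n * (r + p + 1) := by
  classical
  let P : Finset (Finset (Fin m)) := powersetCard (r + p) univ
  have hcard : Fintype.card (P × Fin p) = p * m.choose (r + p) := by
    simp [P, mul_comm]
  obtain ⟨e⟩ : Nonempty (P × Fin p ↪ Fin n) :=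
    Function.Embedding.nonempty_of_card_le (by simpa [hcard] using hn)
  obtain ⟨B, -, hB⟩ := exists_subset_card_eq (s := (univ : Finset (Fin m))) (n := r + p + 1)
    (by simpa using hm)
  let A : Fin n → Finset (Fin m) := Function.extend e (fun x => x.1.1) fun _ => B
  have hAe (x : P × Fin p) : A (e x) = x.1.1 := e.injective.extend_apply _ _ x
  have hAc (j : Fin n) :
      (A j).card + (if j ∈ univ.map e then 1 else 0) = r + p + 1 := by
    by_cases hj : ∃ x, e x = j
    · obtain ⟨x, rfl⟩ := hj
      have := (mem_powersetCard.1 x.1.2).2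
      simp [hAe, this]
    · have : A j = B := Function.extend_apply' _ _ _ hj
      rw [this, hB, if_neg (by simpa using hj)]
  refine ⟨A, fun J hJ hJp => ?_, ?_⟩
  · by_contra! h
    have hle (j : Fin n) : r + p ≤ (A j).card := by
      have := hAc j
      split_ifs at this <;> omega
    have hAU (j) (hj : j ∈ J) : A j = J.biUnion A :=
      eq_of_subset_of_card_le (subset_biUnion_of_mem A hj) (by have := hle j; omega)
    obtain ⟨j₀, hj₀⟩ := card_pos.1 hJ
    have hU : (J.biUnion A).card = r + p := by
      have := hle j₀
      rw [hAU j₀ hj₀] at this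
      omega
    have hUP : J.biUnion A ∈ P := mem_powersetCard.2 ⟨subset_univ _, hU⟩
    have hJsub : J ⊆ univ.image fun i : Fin p => e (⟨J.biUnion A, hUP⟩, i) := by
      intro j hj
      have hjc := hAc j
      rw [hAU j hj, hU] at hjc
      have hje : j ∈ univ.map e := by
        by_contra hje
        simp [hje] at hjc
      obtain ⟨x, -, rfl⟩ := mem_map.1 hje
      refine mem_image.2 ⟨x.2, mem_univ _, congrArg e (Prod.ext (Subtype.ext ?_) rfl)⟩
      exact (hAU _ hj).symm.trans (hAe x)
    have h1 := (card_le_card hJsub).trans card_image_le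
    rw [card_univ, Fintype.card_fin] at h1
    omega
  · have hsum := sum_congr rfl fun j (_ : j ∈ (univ : Finset (Fin n))) => hAc j
    rw [sum_add_distrib, sum_boole, filter_mem_eq_inter, univ_inter, card_map, card_univ,
      hcard] at hsum
    simpa [weight] using hsum

/-- Theorem `thm:nbddbelow`: if `k ≤ m - r` and
`n ≥ (k-1)·C(m, r+k-1)`, then `N(n,k,m;r) = (r+k)n - (k-1)·C(m, r+k-1)`. -/
theorem minWeight_large_n (n m k r : ℕ) (hn : 0 < n) (hm : 0 < m) (hk : 0 < k)
    (hkmr : k ≤ m - r) (hnbig : (k - 1) * Nat.choose m (r + k - 1) ≤ n) :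
    minWeight n k m r = (r + k) * n - (k - 1) * Nat.choose m (r + k - 1) := by
  obtain ⟨p, rfl⟩ : ∃ p, k = p + 1 := ⟨k - 1, by omega⟩
  have hrp : r + p < m := by omega
  simp only [Nat.add_sub_cancel, ← Nat.add_assoc] at hnbig ⊢
  obtain ⟨A, hA, hw⟩ := exists_isRCBC_weight_add_eq hrp hnbig
  rw [mul_comm (r + p + 1) n]
  have hleast : IsLeast {w | ∃ A : Fin n → Finset (Fin m), IsRCBC r (p + 1) A ∧ weight A = w}
      (n * (r + p + 1) - p * m.choose (r + p)) := by
    refine ⟨⟨A, hA, by omega⟩, ?_⟩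
    rintro _ ⟨A', hA', rfl⟩
    exact Nat.sub_le_iff_le_add.2 (hA'.le_weight_add hrp)
  exact hleast.csInf_eq
end

section
/- Let A = (A_1, …, A_n) be an r-CBC(n,k,m), and for each integer i > r let ℓ_i denote the number of indices j ∈ [n] with |A_j| = i. Then Σ_{i=r+1}^{r+k−1} ℓ_i · C(m − i, r + k − 1 − i) ≤ (k − 1)·C(m, r + k − 1). -/
theorem Finset.choose_le_card_filter_subset_powersetCard {α : Type*} [Fintype α]
    [DecidableEq α] (B : Finset α) {s : ℕ} (hB : B.card ≤ s) :
    (Fintype.card α - B.card).choose (s - B.card) ≤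
      ((Finset.univ.powersetCard s).filter fun S => B ⊆ S).card := by
  rw [← Finset.card_compl, ← Finset.card_powersetCard]
  refine Finset.card_le_card_of_injOn (fun T => B ∪ T) ?_ ?_
  · intro T hT
    obtain ⟨hTB, hcard⟩ := Finset.mem_powersetCard.1 hT
    have hdisj : Disjoint B T :=
      (Finset.subset_compl_iff_disjoint_left.1 hTB)
    simp [Finset.mem_powersetCard, Finset.card_union_of_disjoint hdisj, hcard, hB]
  · intro T hT T' hT' h
    have hd := Finset.subset_compl_iff_disjoint_left.1 (Finset.mem_powersetCard.1 hT).1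
    have hd' := Finset.subset_compl_iff_disjoint_left.1 (Finset.mem_powersetCard.1 hT').1
    calc T = (B ∪ T) \ B := (Finset.union_sdiff_cancel_left hd).symm
      _ = (B ∪ T') \ B := congrArg (· \ B) h
      _ = T' := Finset.union_sdiff_cancel_left hd'

theorem IsRCBC.card_filter_subset_lt {r k n m : ℕ} {A : Fin n → Finset (Fin m)}
    (hA : IsRCBC r k A) (hk : 1 ≤ k) {S : Finset (Fin m)} (hS : S.card < r + k) :
    (Finset.univ.filter fun j => A j ⊆ S).card < k := by
  by_contra! h
  obtain ⟨J, hJ, rfl⟩ := Finset.exists_subset_card_eq h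
  have hJS : J.biUnion A ⊆ S :=
    Finset.biUnion_subset.2 fun j hj => (Finset.mem_filter.1 (hJ hj)).2
  have := hA J hk le_rfl
  have := Finset.card_le_card hJS
  omega

/-- Lemma `prop:upperbound`: counting pairs of columns inside
`(r+k-1)`-subsets of rows, where `ℓ_i` is the number of columns of
cardinality `i`. -/
theorem rcbc_counting_bound (n m k r : ℕ) (A : Fin n → Finset (Fin m))
    (hA : IsRCBC r k A) :
    ∑ i ∈ Finset.Icc (r + 1) (r + k - 1),
        (Finset.univ.filter fun j : Fin n => (A j).card = i).card *
          Nat.choose (m - i) (r + k - 1 - i) ≤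
      (k - 1) * Nat.choose m (r + k - 1) := by
  rcases Nat.eq_zero_or_pos k with rfl | hk
  · rw [Finset.Icc_eq_empty (by omega)]
    simp
  set s := r + k - 1 with hs
  let P : Finset (Finset (Fin m)) := Finset.univ.powersetCard s
  calc
    _ = ∑ i ∈ Finset.Icc (r + 1) s, ∑ j with (A j).card = i,
          (m - (A j).card).choose (s - (A j).card) := by
        refine Finset.sum_congr rfl fun i _ => ?_
        rw [← smul_eq_mul, ← Finset.sum_const]
        refine Finset.sum_congr rfl fun j hj => ?_
        rw [(Finset.mem_filter.1 hj).2]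
    _ ≤ ∑ i ∈ Finset.Icc (r + 1) s, ∑ j with (A j).card = i,
          (P.filter fun S => A j ⊆ S).card := by
        refine Finset.sum_le_sum fun i hi => Finset.sum_le_sum fun j hj => ?_
        have hjs : (A j).card ≤ s :=
          (Finset.mem_filter.1 hj).2.trans_le (Finset.mem_Icc.1 hi).2
        simpa using Finset.choose_le_card_filter_subset_powersetCard (A j) hjs
    _ ≤ ∑ j, (P.filter fun S => A j ⊆ S).card :=
        Finset.sum_fiberwise_le_sum_of_sum_fiber_nonneg fun _ _ => Nat.zero_le _
    _ = ∑ S ∈ P, (Finset.univ.filter fun j => A j ⊆ S).card :=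
        Finset.sum_card_bipartiteAbove_eq_sum_card_bipartiteBelow fun j S => A j ⊆ S
    _ ≤ ∑ _S ∈ P, (k - 1) := by
        refine Finset.sum_le_sum fun S hS => ?_
        have hcard := (Finset.mem_powersetCard.1 hS).2
        exact Nat.le_sub_one_of_lt (hA.card_filter_subset_lt hk (by omega))
    _ = (k - 1) * m.choose s := by
        simp [P, mul_comm]
end

section
/- For any three integers i, p, m satisfying 1 ≤ i ≤ p ≤ m − 1, the inequality ⌊(C(m − i, p − i) − 1)/(m − p)⌋ ≥ p − i holds, where ⌊·⌋ denotes the floor and C denotes the binomial coefficient. -/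
theorem le_choose_add_succ (a b : ℕ) : b ≤ (a + b).choose (a + 1) := by
  induction b with
  | zero => exact Nat.zero_le _
  | succ b ih =>
    have hpos : 0 < (a + b).choose a := Nat.choose_pos (Nat.le_add_right a b)
    rw [← add_assoc, Nat.choose_succ_succ']
    omega

theorem mul_lt_choose_add (a b : ℕ) : a * b < (a + b).choose a := by
  induction a with
  | zero => simp
  | succ a ih =>
    rw [add_right_comm, Nat.choose_succ_succ', add_one_mul]
    exact add_lt_add_of_lt_of_le ih (le_choose_add_succ a b)

/-- Lemma 1 of Bujtás–Tuza: for `1 ≤ i ≤ p ≤ m - 1`,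
`⌊(C(m-i, p-i) - 1)/(m - p)⌋ ≥ p - i`. -/
theorem tuza_binomial_div_bound (i p m : ℕ) (h1 : 1 ≤ i) (h2 : i ≤ p)
    (h3 : p ≤ m - 1) :
    p - i ≤ (Nat.choose (m - i) (p - i) - 1) / (m - p) := by
  rw [Nat.le_div_iff_mul_le (by omega), show m - i = (p - i) + (m - p) by omega]
  exact Nat.le_sub_one_of_lt (mul_lt_choose_add _ _)
end

section
/- Let r ≥ 0, k ≥ 3, and m ≥ r + k be integers, and let F(k,m,r) be the largest n such that there exists an r-CBC(n,k,m) in which every column has cardinality r + k − 2. If n is a positive integer with (k − 1)·C(m, r + k − 1) − (m − r − k + 1)·F(k,m,r) ≤ n ≤ (k − 1)·C(m, r + k − 1), then N(n,k,m;r) = (r + k − 1)·n − ⌊((k − 1)·C(m, r + k − 1) − n)/(m − r − k + 1)⌋. -/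
/-- `F(k,m,r)`: the largest `n` such that there exists an `r`-CBC(n,k,m)
all of whose columns have cardinality `r + k - 2`. -/
noncomputable def F (k m r : ℕ) : ℕ :=
  sSup {n | ∃ A : Fin n → Finset (Fin m), IsRCBC r k A ∧
    ∀ j : Fin n, (A j).card = r + k - 2}

open Finset

theorem isRCBC_iff_card_filter_subset_le {r k n m : ℕ} (hk : 1 ≤ k)
    {A : Fin n → Finset (Fin m)} :
    IsRCBC r k A ↔
      ∀ X : Finset (Fin m), #X < r + k → #{j | A j ⊆ X} ≤ #X - r := by
  constructor
  · intro h X hX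
    by_contra! hlt
    obtain ⟨J, hJ, hcard⟩ := exists_subset_card_eq (Nat.succ_le_of_lt hlt)
    have hsub : J.biUnion A ⊆ X :=
      biUnion_subset.2 fun j hj => (mem_filter.1 (hJ hj)).2
    have := card_le_card hsub
    have := h J (by omega) (by omega)
    omega
  · intro h J hJ1 hJk
    by_contra! hlt
    have hsub : J ⊆ ({j | A j ⊆ J.biUnion A} : Finset (Fin n)) := fun j hj =>
      mem_filter.2 ⟨mem_univ _, subset_biUnion_of_mem A hj⟩
    have := card_le_card hsub
    have := h (J.biUnion A) (by omega)
    omega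

theorem IsRCBC.comp_injective {r k n n' m : ℕ} {A : Fin n → Finset (Fin m)}
    (hA : IsRCBC r k A) {f : Fin n' → Fin n} (hf : Function.Injective f) :
    IsRCBC r k (A ∘ f) := by
  intro J hJ1 hJk
  have hcard : #(J.map ⟨f, hf⟩) = #J := card_map _
  have h := hA (J.map ⟨f, hf⟩) (by omega) (by omega)
  have hunion : (J.map ⟨f, hf⟩).biUnion A = J.biUnion (A ∘ f) := by
    ext
    simp
  rwa [hcard, hunion] at h

theorem card_filter_superset_powersetCard {α : Type*} [Fintype α] [DecidableEq α]
    (B : Finset α) {s : ℕ} (hs : #B ≤ s) :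
    #{X ∈ powersetCard s (univ : Finset α) | B ⊆ X} =
      (Fintype.card α - #B).choose (s - #B) := by
  rw [← card_compl, ← card_powersetCard]
  refine card_nbij' (· \ B) (· ∪ B) ?_ ?_ ?_ ?_
  · intro X hX
    simp only [coe_filter, mem_powersetCard_univ, Set.mem_ofPred_eq] at hX
    simp only [mem_coe, mem_powersetCard, card_sdiff_of_subset hX.2, hX.1, and_true]
    intro x hx
    simp_all
  · intro Y hY
    simp only [mem_coe, mem_powersetCard] at hY
    have hdisj : Disjoint Y B := disjoint_left.2 fun x hx => mem_compl.1 (hY.1 hx)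
    simp only [coe_filter, mem_powersetCard_univ, Set.mem_ofPred_eq, subset_union_right,
      and_true, card_union_of_disjoint hdisj]
    omega
  · intro X hX
    simp only [coe_filter, mem_powersetCard_univ, Set.mem_ofPred_eq] at hX
    exact sdiff_union_of_subset hX.2
  · intro Y hY
    simp only [mem_coe, mem_powersetCard] at hY
    have hdisj : Disjoint Y B := disjoint_left.2 fun x hx => mem_compl.1 (hY.1 hx)
    exact union_sdiff_cancel_right hdisj

theorem succ_le_choose_add (d i : ℕ) : d + 1 ≤ (d + 1 + i).choose (i + 1) := by
  induction d with
  | zero => simp [Nat.add_comm 1 i]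
  | succ d ih =>
    rw [show d + 1 + 1 + i = (d + 1 + i) + 1 by ring, Nat.choose_succ_succ']
    have := Nat.choose_pos (show i ≤ d + 1 + i by omega)
    omega

theorem one_add_mul_le_choose {d : ℕ} (hd : 1 ≤ d) (i : ℕ) :
    1 + i * d ≤ (d + i).choose i := by
  obtain ⟨d, rfl⟩ := Nat.exists_eq_add_of_le' hd
  induction i with
  | zero => simp
  | succ i ih =>
    rw [← Nat.add_assoc, Nat.choose_succ_succ']
    have := succ_le_choose_add d i
    linarith

theorem sum_card_filter_subset {n m : ℕ} (A : Fin n → Finset (Fin m)) (s : ℕ) :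
    ∑ X ∈ powersetCard s (univ : Finset (Fin m)), #{j | A j ⊆ X} =
      ∑ j, #{X ∈ powersetCard s (univ : Finset (Fin m)) | A j ⊆ X} := by
  simp only [card_filter]
  exact sum_comm

theorem IsRCBC.sum_card_superset_le {r k n m : ℕ} (hk : 1 ≤ k) {A : Fin n → Finset (Fin m)}
    (hA : IsRCBC r k A) :
    ∑ j, #{X ∈ powersetCard (r + k - 1) (univ : Finset (Fin m)) | A j ⊆ X} ≤
      (k - 1) * m.choose (r + k - 1) := by
  rw [← sum_card_filter_subset]
  calc _ ≤ ∑ _X ∈ powersetCard (r + k - 1) (univ : Finset (Fin m)), (k - 1) := by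
        refine sum_le_sum fun X hX => ?_
        have hc := mem_powersetCard_univ.1 hX
        have := (isRCBC_iff_card_filter_subset_le hk).1 hA X (by omega)
        omega
    _ = _ := by simp [mul_comm]

theorem IsRCBC.add_mul_le_add_mul_weight {r k n m : ℕ} (hk : 1 ≤ k) (hm : r + k ≤ m)
    {A : Fin n → Finset (Fin m)} (hA : IsRCBC r k A) :
    n + (m - r - k + 1) * ((r + k - 1) * n) ≤
      (k - 1) * m.choose (r + k - 1) + (m - r - k + 1) * weight A := by
  have hcol : ∀ j, 1 + (m - r - k + 1) * (r + k - 1) ≤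
      #{X ∈ powersetCard (r + k - 1) (univ : Finset (Fin m)) | A j ⊆ X} +
        (m - r - k + 1) * #(A j) := by
    intro j
    rcases le_or_gt #(A j) (r + k - 1) with hle | hlt
    · rw [card_filter_superset_powersetCard _ hle, Fintype.card_fin]
      obtain ⟨i, hi⟩ := Nat.exists_eq_add_of_le hle
      have h := one_add_mul_le_choose (show 1 ≤ m - r - k + 1 by omega) i
      rw [show m - #(A j) = m - r - k + 1 + i by omega,
        show r + k - 1 - #(A j) = i by omega, hi]
      linarith
    · have := Nat.mul_le_mul_left (m - r - k + 1) (Nat.succ_le_of_lt hlt)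
      rw [Nat.succ_eq_add_one, mul_add] at this
      omega
  have hsum := sum_le_sum fun j (_ : j ∈ univ) => hcol j
  simp only [sum_add_distrib, ← mul_sum, sum_const, card_univ, Fintype.card_fin,
    smul_eq_mul] at hsum
  have := hA.sum_card_superset_le hk
  unfold weight
  linarith

theorem card_superset_of_card_eq {r k m : ℕ} (hk : 2 ≤ k) (hm : r + k ≤ m)
    {B : Finset (Fin m)} (hB : #B = r + k - 2) :
    #{X ∈ powersetCard (r + k - 1) (univ : Finset (Fin m)) | B ⊆ X} =
      m - r - k + 1 + 1 := by
  rw [card_filter_superset_powersetCard _ (by omega), Fintype.card_fin, hB,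
    show r + k - 1 - (r + k - 2) = 1 by omega, Nat.choose_one_right]
  omega

theorem IsRCBC.succ_mul_le {r k n m : ℕ} (hk : 2 ≤ k) (hm : r + k ≤ m)
    {A : Fin n → Finset (Fin m)} (hA : IsRCBC r k A) (hcard : ∀ j, #(A j) = r + k - 2) :
    n * (m - r - k + 1 + 1) ≤ (k - 1) * m.choose (r + k - 1) := by
  have h := hA.sum_card_superset_le (by omega)
  simpa [card_superset_of_card_eq hk hm (hcard _)] using h

theorem exists_isRCBC_F {r k m : ℕ} (hk : 2 ≤ k) (hm : r + k ≤ m) :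
    ∃ A : Fin (F k m r) → Finset (Fin m), IsRCBC r k A ∧ ∀ j, #(A j) = r + k - 2 := by
  refine Nat.sSup_mem (s := {n | ∃ A : Fin n → Finset (Fin m), IsRCBC r k A ∧
    ∀ j : Fin n, #(A j) = r + k - 2}) ⟨0, Fin.elim0, ?_, fun j => j.elim0⟩
    ⟨(k - 1) * m.choose (r + k - 1), ?_⟩
  · intro J hJ
    simp [Subsingleton.elim J ∅] at hJ
  · rintro n ⟨A, hA, hcard⟩
    exact (Nat.le_mul_of_pos_right n (Nat.succ_pos _)).trans (hA.succ_mul_le hk hm hcard)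

/-- Columns of size `r + k - 2` can be completed by columns of size `r + k - 1` as long as the
`(r + k - 1)`-subsets of `Fin m` have spare capacity. -/
theorem IsRCBC.exists_append {r k q p m : ℕ} (hk : 2 ≤ k) (hm : r + k ≤ m)
    {B : Fin q → Finset (Fin m)} (hB : IsRCBC r k B) (hcard : ∀ j, #(B j) = r + k - 2)
    (hp : p + q * (m - r - k + 1 + 1) ≤ (k - 1) * m.choose (r + k - 1)) :
    ∃ C : Fin p → Finset (Fin m), (∀ i, #(C i) = r + k - 1) ∧
      IsRCBC r k (Fin.append B C) := by
  have hB' := (isRCBC_iff_card_filter_subset_le (by omega)).1 hB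
  let res : Finset (Fin m) → ℕ := fun X => k - 1 - #{j | B j ⊆ X}
  let P : Finset (Σ _ : Finset (Fin m), ℕ) :=
    (powersetCard (r + k - 1) univ).sigma fun X => range (res X)
  have hP : p ≤ #P := by
    have h1 : #P + ∑ X ∈ powersetCard (r + k - 1) (univ : Finset (Fin m)), #{j | B j ⊆ X} =
        (k - 1) * m.choose (r + k - 1) := by
      rw [card_sigma, ← sum_add_distrib]
      calc _ = ∑ _X ∈ powersetCard (r + k - 1) (univ : Finset (Fin m)), (k - 1) := by
            refine sum_congr rfl fun X hX => ?_
            have hc := mem_powersetCard_univ.1 hX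
            have := hB' X (by omega)
            simp only [card_range, res]
            omega
        _ = _ := by simp [mul_comm]
    rw [sum_card_filter_subset] at h1
    simp only [card_superset_of_card_eq hk hm (hcard _), sum_const, card_univ, Fintype.card_fin,
      smul_eq_mul] at h1
    omega
  obtain ⟨e⟩ : Nonempty (Fin p ↪ P) :=
    Function.Embedding.nonempty_of_card_le (by simpa using hP)
  have hmem : ∀ i, #(e i).1.1 = r + k - 1 ∧ (e i).1.2 < res (e i).1.1 := fun i => by
    simpa [P] using mem_sigma.1 (e i).2
  refine ⟨fun i => (e i).1.1, fun i => (hmem i).1, ?_⟩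
  rw [isRCBC_iff_card_filter_subset_le (by omega)]
  intro X hX
  have hsplit : #{j | Fin.append B (fun i => (e i).1.1) j ⊆ X} =
      #{j | B j ⊆ X} + #{i | (e i).1.1 ⊆ X} := by
    simp only [card_filter, Fin.sum_univ_add, Fin.append_left, Fin.append_right]
  rw [hsplit]
  have hle := hB' X hX
  rcases Nat.lt_or_ge #X (r + k - 1) with hlt | hge
  · have : #{i | (e i).1.1 ⊆ X} = 0 := by
      rw [card_eq_zero, filter_eq_empty_iff]
      intro i _ hsub
      have := card_le_card hsub
      have := (hmem i).1
      omega
    omega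
  · have heq : ∀ i ∈ ({i | (e i).1.1 ⊆ X} : Finset (Fin p)), (e i).1.1 = X := fun i hi =>
      eq_of_subset_of_card_le (mem_filter.1 hi).2 (by have := (hmem i).1; omega)
    have : #{i | (e i).1.1 ⊆ X} ≤ #(range (res X)) := by
      refine card_le_card_of_injOn (fun i => (e i).1.2) ?_ ?_
      · intro i hi
        have h := (hmem i).2
        rw [heq i hi] at h
        simpa using h
      · intro i hi j hj hij
        refine e.injective (Subtype.ext (Sigma.ext ?_ (heq_of_eq hij)))
        rw [heq i hi, heq j hj]
    simp only [card_range, res] at this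
    omega

/-- Theorem `thm:fmkr`: for
`(k-1)·C(m,r+k-1) - (m-r-k+1)·F(k,m,r) ≤ n ≤ (k-1)·C(m,r+k-1)`,
`N(n,k,m;r) = (r+k-1)n - ⌊((k-1)·C(m,r+k-1) - n)/(m-r-k+1)⌋`. -/
theorem minWeight_gap (n m k r : ℕ) (hk : 3 ≤ k) (hm : r + k ≤ m) (hn : 0 < n)
    (hlow : (k - 1) * Nat.choose m (r + k - 1) - (m - r - k + 1) * F k m r ≤ n)
    (hhigh : n ≤ (k - 1) * Nat.choose m (r + k - 1)) :
    minWeight n k m r = (r + k - 1) * n -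
      ((k - 1) * Nat.choose m (r + k - 1) - n) / (m - r - k + 1) := by
  have hn' : 0 < m - r - k + 1 := Nat.succ_pos _
  obtain ⟨A, hA, hAcard⟩ := exists_isRCBC_F (r := r) (m := m) (by omega : 2 ≤ k) hm
  have hF := hA.succ_mul_le (by omega) hm hAcard
  have hlower : ∀ B : Fin n → Finset (Fin m), IsRCBC r k B →
      (r + k - 1) * n - ((k - 1) * m.choose (r + k - 1) - n) / (m - r - k + 1) ≤ weight B := by
    intro B hB
    have h := hB.add_mul_le_add_mul_weight (by omega) hm
    rw [Nat.sub_le_iff_le_add', ← Nat.sub_le_iff_le_add, Nat.le_div_iff_mul_le hn', Nat.sub_mul,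
      mul_comm _ (m - r - k + 1), mul_comm (weight B)]
    omega
  obtain ⟨q, hq⟩ : ∃ q, q = ((k - 1) * m.choose (r + k - 1) - n) / (m - r - k + 1) := ⟨_, rfl⟩
  have hqd : q * (m - r - k + 1) ≤ (k - 1) * m.choose (r + k - 1) - n :=
    hq ▸ Nat.div_mul_le_self _ _
  have hqF : q ≤ F k m r := by
    refine Nat.le_of_mul_le_mul_right (hqd.trans ?_) hn'
    rw [mul_comm (F k m r)]
    omega
  have hqn : q ≤ n := by
    rw [mul_add, mul_one, mul_comm (F k m r)] at hF
    omega
  obtain ⟨p, rfl⟩ := Nat.exists_eq_add_of_le hqn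
  have hinj := Fin.castLE_injective hqF
  obtain ⟨C, hC, hBC⟩ := (hA.comp_injective hinj).exists_append (p := p) (by omega) hm
    (fun j => hAcard _) (by rw [mul_add, mul_one]; omega)
  have hweight : weight (Fin.append (A ∘ Fin.castLE hqF) C) = (r + k - 1) * (q + p) - q := by
    have hsub : q * (r + k - 2) + q = q * (r + k - 1) := by
      rw [← Nat.mul_succ]
      congr 1
      omega
    simp only [weight, Fin.sum_univ_add, Fin.append_left, Fin.append_right, Function.comp_apply,
      hAcard, hC, sum_const, card_univ, Fintype.card_fin, smul_eq_mul]
    rw [mul_add, mul_comm _ q, mul_comm _ p, ← hsub]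
    omega
  rw [← hq] at hlower ⊢
  refine le_antisymm (Nat.sInf_le ⟨_, hBC, hweight⟩) (le_csInf ⟨_, _, hBC, rfl⟩ ?_)
  rintro _ ⟨B, hB, rfl⟩
  exact hlower B hB
end

section
/- Let k ≥ 3, r ≥ 0 and m ≥ r + k be integers and set g = m − (r + k). Let B_1, …, B_n be (not necessarily distinct) subsets of [m], each of cardinality g + 2, such that (a) every (g + 1)-element subset of [m] is contained in at most k − 1 of the sets B_1, …, B_n (counted with multiplicity), and (b) no set occurs more than k − 2 times among B_1, …, B_n, i.e., for every set S, |{i ∈ [n] : B_i = S}| ≤ k − 2. Then the family of complements A = (A_1, …, A_n), where A_i = [m] \ B_i, is an r-CBC(n,k,m). -/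
/-- Lemma `lemma:design_rcbc`: the complements of the blocks of
a `(g+1)-(m, g+2, k-1)` packing design with property (P), where
`g = m - (r+k)`, form an `r`-CBC(n,k,m). -/
theorem packing_design_complement_rcbc (n m k r g : ℕ) (hk : 3 ≤ k)
    (hm : r + k ≤ m) (hg : g = m - (r + k))
    (B : Fin n → Finset (Fin m)) (hcard : ∀ i : Fin n, (B i).card = g + 2)
    (hpack : ∀ S : Finset (Fin m), S.card = g + 1 →
      (Finset.univ.filter fun i : Fin n => S ⊆ B i).card ≤ k - 1)
    (hP : ∀ S : Finset (Fin m),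
      (Finset.univ.filter fun i : Fin n => B i = S).card ≤ k - 2) :
    IsRCBC r k (fun i : Fin n => (B i)ᶜ) := by
  intro J hJ1 hJk
  obtain ⟨j, hj⟩ := Finset.card_pos.mp hJ1
  set T := (J.biUnion fun i => (B i)ᶜ)ᶜ with hT
  have hTB : ∀ i ∈ J, T ⊆ B i := by
    intro i hi x hx
    simp only [hT, Finset.mem_compl, Finset.mem_biUnion, not_exists, not_and, not_not] at hx
    exact hx i hi
  have hTcard : (J.biUnion fun i => (B i)ᶜ).card + T.card = m :=
    (Finset.card_add_card_compl _).trans (Fintype.card_fin m)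
  have hle : T.card ≤ g + 2 := hcard j ▸ Finset.card_le_card (hTB j hj)
  suffices T.card + J.card ≤ g + k by omega
  by_contra! hlt
  rcases hJk.eq_or_lt with hJ | hJ
  · obtain ⟨S, hST, hS⟩ := Finset.exists_subset_card_eq (show g + 1 ≤ T.card by omega)
    have hsub : J ⊆ Finset.univ.filter fun i : Fin n => S ⊆ B i := fun i hi =>
      Finset.mem_filter.mpr ⟨Finset.mem_univ i, hST.trans (hTB i hi)⟩
    have := (Finset.card_le_card hsub).trans (hpack S hS)
    omega
  · have hsub : J ⊆ Finset.univ.filter fun i : Fin n => B i = T := fun i hi =>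
      Finset.mem_filter.mpr ⟨Finset.mem_univ i,
        (Finset.eq_of_subset_of_card_le (hTB i hi) (by rw [hcard i]; omega)).symm⟩
    have := (Finset.card_le_card hsub).trans (hP T)
    omega
end

section
/- Let k, m, n be integers with 2 ≤ k < m ≤ n, and let A = (A_1, …, A_n) be a family of subsets of [m]. Then A is a 1-CBC(n,k,m) with weight N(A) = 2n if and only if every A_j has exactly two elements, the sets A_1, …, A_n are pairwise distinct, and the simple graph G on vertex set [m] whose edge set is {A_1, …, A_n} has girth at least k + 1 (i.e., G contains no cycle of length at most k). -/
namespace SimpleGraph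

variable {V : Type*} {G : SimpleGraph V}

/-- A forest on a nonempty finite vertex set has fewer edges than vertices. -/
theorem IsAcyclic.ncard_edgeSet_lt [Finite V] [Nonempty V] (h : G.IsAcyclic) :
    G.edgeSet.ncard < Nat.card V := by
  classical
  have := Fintype.ofFinite V
  obtain ⟨T, hGT, -, hT⟩ := connected_top.exists_isTree_le_of_le_of_isAcyclic le_top h
  have hcard := hT.card_edgeFinset
  have hle : G.edgeSet.ncard ≤ T.edgeSet.ncard :=
    Set.ncard_le_ncard (edgeSet_mono hGT) (Set.toFinite _)
  rw [← coe_edgeFinset T, Set.ncard_coe_finset] at hle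
  rw [Nat.card_eq_fintype_card]
  omega

/-- A nonempty set of edges of a forest spans more vertices than it has edges. -/
theorem IsAcyclic.card_lt_card_of_subset_sym2 (h : G.IsAcyclic) [DecidableEq V]
    {F : Finset (Sym2 V)} {U : Finset V} (hF : ∀ e ∈ F, e ∈ G.edgeSet)
    (hU : ∀ e ∈ F, ∀ v ∈ e, v ∈ U) (hne : U.Nonempty) : F.card < U.card := by
  have : Nonempty (U : Set V) := hne.to_subtype
  have hlt := (h.induce (U : Set V)).ncard_edgeSet_lt
  have hsub : (F : Set (Sym2 V)) ⊆
      Sym2.map Subtype.val '' (G.induce (U : Set V)).edgeSet := by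
    intro e he
    induction e with
    | h u v =>
      refine ⟨s(⟨u, hU _ he u (by simp)⟩, ⟨v, hU _ he v (by simp)⟩), ?_, by simp⟩
      simpa using hF _ he
  have hle := (Set.ncard_le_ncard hsub (Set.toFinite _)).trans (Set.ncard_image_le (Set.toFinite _))
  rw [Set.ncard_coe_finset] at hle
  simp only [Finset.coe_sort_coe, Nat.card_eq_fintype_card, Fintype.card_coe] at hlt
  exact hle.trans_lt hlt

/-- The edges of a closed walk cover at most as many vertices as the length of the walk. -/
theorem Walk.card_le_length_of_forall_mem_edges [DecidableEq V] {v : V} (w : G.Walk v v)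
    {U : Finset V} (hU : ∀ u ∈ U, ∃ e ∈ w.edges, u ∈ e) : U.card ≤ w.length := by
  have hsub : U ⊆ w.support.tail.toFinset := by
    intro u hu
    obtain ⟨e, he, hue⟩ := hU u hu
    have hnil : ¬ w.Nil := by
      intro h
      simp [Walk.eq_nil_iff_nil.mpr h] at he
    have hmem : u ∈ w.support := by
      obtain ⟨x, rfl⟩ := hue
      exact w.fst_mem_support_of_mem_edges he
    rw [List.mem_toFinset]
    rcases (Walk.mem_support_iff w).mp hmem with rfl | h
    · exact w.end_mem_tail_support hnil
    · exact h
  calc U.card ≤ w.support.tail.toFinset.card := Finset.card_le_card hsub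
    _ ≤ w.support.tail.length := List.toFinset_card_le _
    _ = w.length := by simp

end SimpleGraph

section Codes

variable {n m k : ℕ} {A : Fin n → Finset (Fin m)} {e : Fin n → Sym2 (Fin m)}

theorem card_eq_two_of_isRCBC (hk : 1 ≤ k) (hA : IsRCBC 1 k A) (hw : weight A = 2 * n)
    (j : Fin n) : (A j).card = 2 := by
  have hle : ∀ i ∈ Finset.univ, 2 ≤ (A i).card := fun i _ => by
    simpa using hA {i} (by simp) (by simpa using hk)
  have hsum : ∑ _i : Fin n, 2 = ∑ i, (A i).card := by
    rw [← weight, hw]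
    simp [mul_comm]
  exact ((Finset.sum_eq_sum_iff_of_le hle).mp hsum j (Finset.mem_univ j)).symm

theorem injective_of_isRCBC (hk : 2 ≤ k) (hA : IsRCBC 1 k A) (h2 : ∀ j, (A j).card = 2) :
    Function.Injective A := by
  intro i j hij
  by_contra hne
  have h := hA {i, j} (by simp [Finset.card_pair hne]) (by simpa [Finset.card_pair hne] using hk)
  simp [Finset.card_pair hne, Finset.biUnion_insert, hij, h2] at h

/-- A family of distinct pairs is the family of vertex sets of distinct non-loop edges. -/
theorem exists_edges_of_card_eq_two (h2 : ∀ j, (A j).card = 2) (hinj : Function.Injective A) :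
    ∃ e : Fin n → Sym2 (Fin m), Function.Injective e ∧ (∀ j, ¬ (e j).IsDiag) ∧
      (∀ j v, v ∈ A j ↔ v ∈ e j) ∧
      {e : Sym2 (Fin m) | ∃ (j : Fin n) (u v : Fin m), e = s(u, v) ∧ A j = {u, v}} =
        Set.range e := by
  choose u v huv hA using fun j => Finset.card_eq_two.mp (h2 j)
  have hmem : ∀ j x, x ∈ A j ↔ x ∈ s(u j, v j) := fun j x => by simp [hA j]
  refine ⟨fun j => s(u j, v j), fun i j hij => hinj ?_, fun j => by simpa using huv j, hmem, ?_⟩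
  · ext x
    rw [hmem, hmem]
    exact iff_of_eq (congrArg (x ∈ ·) hij)
  · ext f
    constructor
    · rintro ⟨j, a, b, rfl, hab⟩
      refine ⟨j, Sym2.ext fun x => ?_⟩
      rw [← hmem, hab]
      simp
    · rintro ⟨j, rfl⟩
      exact ⟨j, u j, v j, rfl, hA j⟩

theorem lt_length_of_isRCBC (hA : IsRCBC 1 k A) (he : Function.Injective e)
    (hmem : ∀ j v, v ∈ A j ↔ v ∈ e j) {a : Fin m}
    {w : (SimpleGraph.fromEdgeSet (Set.range e)).Walk a a} (hw : w.IsCycle) : k < w.length := by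
  classical
  by_contra! hle
  let J : Finset (Fin n) := {j | e j ∈ w.edges}
  have himage : J.image e = w.edges.toFinset := by
    ext f
    simp only [J, Finset.mem_image, Finset.mem_filter, Finset.mem_univ, true_and,
      List.mem_toFinset]
    refine ⟨by rintro ⟨j, hj, rfl⟩; exact hj, fun hf => ?_⟩
    have hmemf := w.edges_subset_edgeSet hf
    rw [SimpleGraph.edgeSet_fromEdgeSet] at hmemf
    obtain ⟨j, rfl⟩ := hmemf.1
    exact ⟨j, hf, rfl⟩
  have hcard : J.card = w.length := by
    rw [← Finset.card_image_of_injective J he, himage,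
      List.toFinset_card_of_nodup hw.edges_nodup, w.length_edges]
  have hlen := hw.three_le_length
  have hunion : (J.biUnion A).card ≤ w.length := by
    refine w.card_le_length_of_forall_mem_edges fun x hx => ?_
    obtain ⟨j, hj, hx⟩ := Finset.mem_biUnion.mp hx
    exact ⟨e j, (Finset.mem_filter.mp hj).2, (hmem j x).mp hx⟩
  have := hA J (by omega) (by omega)
  omega

theorem isRCBC_of_lt_length (he : Function.Injective e) (hdiag : ∀ j, ¬ (e j).IsDiag)
    (hmem : ∀ j v, v ∈ A j ↔ v ∈ e j)
    (hcycle : ∀ a (w : (SimpleGraph.fromEdgeSet (Set.range e)).Walk a a),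
      w.IsCycle → k < w.length) : IsRCBC 1 k A := by
  classical
  intro J hJ hJk
  have hacyc : (SimpleGraph.fromEdgeSet (e '' J)).IsAcyclic := by
    intro a w hw
    have hlt := hcycle a _
      (hw.mapLe (SimpleGraph.fromEdgeSet_mono (Set.image_subset_range e J)))
    have hsub : w.edges.toFinset ⊆ J.image e := by
      intro f hf
      have hmemf := w.edges_subset_edgeSet (List.mem_toFinset.mp hf)
      rw [SimpleGraph.edgeSet_fromEdgeSet] at hmemf
      simpa using hmemf.1
    have hle := (Finset.card_le_card hsub).trans Finset.card_image_le
    rw [List.toFinset_card_of_nodup hw.edges_nodup, w.length_edges] at hle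
    simp only [SimpleGraph.Walk.length_map] at hlt
    omega
  have hlt := hacyc.card_lt_card_of_subset_sym2 (F := J.image e) (U := J.biUnion A)
    (fun f hf => by
      obtain ⟨j, hj, rfl⟩ := Finset.mem_image.mp hf
      rw [SimpleGraph.edgeSet_fromEdgeSet]
      exact ⟨⟨j, hj, rfl⟩, hdiag j⟩)
    (fun f hf x hx => by
      obtain ⟨j, hj, rfl⟩ := Finset.mem_image.mp hf
      exact Finset.mem_biUnion.mpr ⟨j, hj, (hmem j x).mpr hx⟩)
    (by
      obtain ⟨j, hj⟩ := Finset.card_pos.mp hJ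
      exact ⟨(e j).out.1, Finset.mem_biUnion.mpr ⟨j, hj, (hmem j _).mpr (Sym2.out_fst_mem _)⟩⟩)
  rw [Finset.card_image_of_injective J he] at hlt
  omega

/-- A graph with at least as many edges as vertices, and some vertex, has a cycle. -/
theorem not_isAcyclic_fromEdgeSet_range (hm : 0 < m) (hmn : m ≤ n)
    (he : Function.Injective e) (hdiag : ∀ j, ¬ (e j).IsDiag) :
    ¬ (SimpleGraph.fromEdgeSet (Set.range e)).IsAcyclic := by
  intro h
  have : Nonempty (Fin m) := ⟨⟨0, hm⟩⟩
  have hlt := h.card_lt_card_of_subset_sym2 (F := Finset.univ.image e) (U := Finset.univ)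
    (fun f hf => by
      obtain ⟨j, -, rfl⟩ := Finset.mem_image.mp hf
      rw [SimpleGraph.edgeSet_fromEdgeSet]
      exact ⟨⟨j, rfl⟩, hdiag j⟩)
    (by simp) Finset.univ_nonempty
  rw [Finset.card_image_of_injective _ he] at hlt
  simp at hlt
  omega

end Codes

/-- a family `A` is a `1`-CBC(n,k,m) of weight `2n` iff all its
members are (pairwise distinct) `2`-element sets and the simple graph on `[m]`
whose edges are the sets `A_j` has girth at least `k + 1`. -/
theorem one_cbc_iff_girth (n m k : ℕ) (hk : 2 ≤ k) (hkm : k < m) (hmn : m ≤ n)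
    (A : Fin n → Finset (Fin m)) :
    (IsRCBC 1 k A ∧ weight A = 2 * n) ↔
      ((∀ j : Fin n, (A j).card = 2) ∧ Function.Injective A ∧
        ((k : ℕ∞) + 1) ≤
          (SimpleGraph.fromEdgeSet
            {e : Sym2 (Fin m) | ∃ (j : Fin n) (u v : Fin m),
              e = s(u, v) ∧ A j = {u, v}}).girth) := by
  have hgirth : ∀ e : Fin n → Sym2 (Fin m), Function.Injective e → (∀ j, ¬ (e j).IsDiag) →
      (((k : ℕ∞) + 1) ≤ (SimpleGraph.fromEdgeSet (Set.range e)).girth ↔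
        ∀ a (w : (SimpleGraph.fromEdgeSet (Set.range e)).Walk a a),
          w.IsCycle → k < w.length) := by
    intro e he hdiag
    norm_cast
    rw [Nat.add_one_le_iff]
    refine ⟨fun h a w hw => h.trans_le (SimpleGraph.girth_le_length hw), fun h => ?_⟩
    obtain ⟨a, w, hw, hlen⟩ := SimpleGraph.exists_girth_eq_length.mpr
      (not_isAcyclic_fromEdgeSet_range (by omega) hmn he hdiag)
    exact hlen ▸ h a w hw
  constructor
  · rintro ⟨hA, hw⟩
    have h2 := card_eq_two_of_isRCBC (by omega) hA hw
    have hinj := injective_of_isRCBC hk hA h2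
    obtain ⟨e, he, hdiag, hmem, hrange⟩ := exists_edges_of_card_eq_two h2 hinj
    rw [hrange, hgirth e he hdiag]
    exact ⟨h2, hinj, fun a w => lt_length_of_isRCBC hA he hmem⟩
  · rintro ⟨h2, hinj, hg⟩
    obtain ⟨e, he, hdiag, hmem, hrange⟩ := exists_edges_of_card_eq_two h2 hinj
    rw [hrange, hgirth e he hdiag] at hg
    exact ⟨isRCBC_of_lt_length he hdiag hmem hg, by simp [weight, h2, mul_comm]⟩
end

section
/- For every integer m ≥ 3, the largest n for which there exists a 1-CBC(n,2,m) of weight 2n is n(2,m;1) = C(m,2) = m(m−1)/2; and for every integer m ≥ 4, the largest n for which there exists a 1-CBC(n,3,m) of weight 2n is n(3,m;1) = ⌊m²/4⌋. -/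
/-- `n(k,m;r)`: the largest `n` such that there exists an `r`-CBC(n,k,m) of
the minimum possible weight `(r+1)n`. -/
noncomputable def nMax (k m r : ℕ) : ℕ :=
  sSup {n | ∃ A : Fin n → Finset (Fin m), IsRCBC r k A ∧
    weight A = (r + 1) * n}

namespace IsRCBC

variable {k m n : ℕ} {A : Fin n → Finset (Fin m)}

lemma card_eq_two (h : IsRCBC 1 k A) (hk : 1 ≤ k) (hw : weight A = (1 + 1) * n) (j : Fin n) :
    (A j).card = 2 := by
  have hle : ∀ i ∈ Finset.univ, 2 ≤ (A i).card := fun i _ => by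
    simpa using h {i} (by simp) (by simpa using hk)
  have hsum : ∑ _i : Fin n, 2 = ∑ i, (A i).card := by
    rw [← weight, hw]
    simp [mul_comm]
  exact ((Finset.sum_eq_sum_iff_of_le hle).1 hsum j (Finset.mem_univ j)).symm

lemma injective (h : IsRCBC 1 k A) (hk : 2 ≤ k) (hw : weight A = (1 + 1) * n) :
    Function.Injective A := by
  intro i j hij
  by_contra hne
  have hc : ({i, j} : Finset (Fin n)).card = 2 := Finset.card_pair hne
  have := h {i, j} (by omega) (by omega)
  have h2 := h.card_eq_two (by omega) hw j
  simp only [hc, Finset.biUnion_insert, Finset.singleton_biUnion, hij, Finset.union_self] at this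
  omega

lemma le_choose_two (h : IsRCBC 1 k A) (hk : 2 ≤ k) (hw : weight A = (1 + 1) * n) :
    n ≤ m.choose 2 := by
  have := Finset.card_le_card_of_injOn (s := Finset.univ)
    (t := Finset.powersetCard 2 (Finset.univ : Finset (Fin m))) A
    (fun j _ => by simpa using h.card_eq_two (by omega) hw j)
    (h.injective hk hw).injOn
  simpa using this

/-- The graph on `Fin m` whose edges are the two-element columns of `A`. -/
def columnGraph (A : Fin n → Finset (Fin m)) : SimpleGraph (Fin m) where
  Adj a b := a ≠ b ∧ ∃ j, A j = {a, b}
  symm := ⟨fun a b ⟨hne, j, hj⟩ => ⟨hne.symm, j, by rw [hj, Finset.pair_comm]⟩⟩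
  loopless := ⟨fun _ h => h.1 rfl⟩

lemma columnGraph_cliqueFree (h : IsRCBC 1 3 A) : (columnGraph A).CliqueFree 3 := by
  intro s hs
  obtain ⟨a, b, c, ⟨hab, i, hi⟩, ⟨hac, j, hj⟩, ⟨hbc, l, hl⟩, rfl⟩ :=
    SimpleGraph.is3Clique_iff.1 hs
  have hij : i ≠ j := by
    rintro rfl
    have : b ∈ A i := by simp [hi]
    rw [hj] at this
    simp [hab.symm, hbc] at this
  have hil : i ≠ l := by
    rintro rfl
    have : a ∈ A i := by simp [hi]
    rw [hl] at this
    simp [hab, hac] at this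
  have hjl : j ≠ l := by
    rintro rfl
    have : a ∈ A j := by simp [hj]
    rw [hl] at this
    simp [hab, hac] at this
  have hc : ({i, j, l} : Finset (Fin n)).card = 3 := Finset.card_eq_three.2
    ⟨i, j, l, hij, hil, hjl, rfl⟩
  have h4 := h {i, j, l} (by omega) (by omega)
  have hsub : ({i, j, l} : Finset (Fin n)).biUnion A ⊆ {a, b, c} := by
    intro x
    simp only [Finset.mem_biUnion, Finset.mem_insert, Finset.mem_singleton, exists_eq_or_imp,
      exists_eq_left, hi, hj, hl]
    tauto
  have := (Finset.card_le_card hsub).trans Finset.card_le_three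
  omega

lemma le_sq_div_four (h : IsRCBC 1 3 A) (hw : weight A = (1 + 1) * n) : n ≤ m ^ 2 / 4 := by
  classical
  have hsub : Finset.univ.image A ⊆ (columnGraph A).edgeFinset.image Sym2.toFinset := by
    intro s hs
    obtain ⟨j, -, rfl⟩ := Finset.mem_image.1 hs
    obtain ⟨a, b, hab, hj⟩ := Finset.card_eq_two.1 (h.card_eq_two (by omega) hw j)
    refine Finset.mem_image.2 ⟨s(a, b), ?_, by rw [hj, Sym2.toFinset_mk_eq]⟩
    rw [SimpleGraph.mem_edgeFinset, SimpleGraph.mem_edgeSet]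
    exact ⟨hab, j, hj⟩
  have hn : n ≤ (columnGraph A).edgeFinset.card := by
    have := (Finset.card_le_card hsub).trans Finset.card_image_le
    rwa [Finset.card_image_of_injective _ (h.injective (by omega) hw), Finset.card_univ,
      Fintype.card_fin] at this
  have hT := (columnGraph_cliqueFree h).card_edgeFinset_le (r := 2)
  simp only [Fintype.card_fin] at hT
  refine hn.trans (hT.trans ?_)
  have hmod : m % 2 = 0 ∨ m % 2 = 1 := by omega
  rcases hmod with hr | hr
  · simp [hr]
  · simp [hr]
    omega

end IsRCBC

lemma exists_isRCBC_choose_two (m : ℕ) :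
    ∃ A : Fin (m.choose 2) → Finset (Fin m), IsRCBC 1 2 A ∧
      weight A = (1 + 1) * m.choose 2 := by
  let e := (Finset.powersetCard 2 (Finset.univ : Finset (Fin m))).equivFinOfCardEq
    (n := m.choose 2) (by simp)
  have hcard (i) : (e.symm i : Finset (Fin m)).card = 2 :=
    (Finset.mem_powersetCard.1 (e.symm i).2).2
  refine ⟨fun i => e.symm i, fun J h1 h2 => ?_, by simp [weight, hcard, mul_comm]⟩
  set U := J.biUnion fun i => (e.symm i : Finset (Fin m)) with hU
  have hJ : J.card ≤ U.card.choose 2 := by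
    rw [← Finset.card_powersetCard]
    refine Finset.card_le_card_of_injOn (fun i => (e.symm i : Finset (Fin m))) (fun i hi => ?_)
      (Subtype.val_injective.comp e.symm.injective).injOn
    exact Finset.mem_powersetCard.2
      ⟨Finset.subset_biUnion_of_mem (fun i => (e.symm i : Finset (Fin m))) hi, hcard i⟩
  by_contra! hlt
  have hle := hJ.trans (Nat.choose_le_choose 2 (show U.card ≤ J.card by omega))
  generalize J.card = c at *
  interval_cases c <;> simp at hle

lemma exists_isRCBC_mul (a b : ℕ) :
    ∃ A : Fin (a * b) → Finset (Fin (a + b)), IsRCBC 1 3 A ∧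
      weight A = (1 + 1) * (a * b) := by
  let p : Fin (a * b) ≃ Fin a × Fin b := finProdFinEquiv.symm
  have hne (i : Fin a) (j : Fin b) : Fin.castAdd b i ≠ Fin.natAdd a j := by
    simp only [ne_eq, Fin.ext_iff, Fin.val_castAdd, Fin.val_natAdd]
    omega
  refine ⟨fun i => {Fin.castAdd b (p i).1, Fin.natAdd a (p i).2}, fun J h1 h3 => ?_, by
    simp [weight, Finset.card_pair (hne _ _), mul_comm]⟩
  set L := J.image fun i => (p i).1
  set R := J.image fun i => (p i).2
  have hJ : J.card ≤ L.card * R.card := by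
    rw [← Finset.card_product]
    exact Finset.card_le_card_of_injOn p (fun i hi => Finset.mem_product.2
      ⟨Finset.mem_image_of_mem _ hi, Finset.mem_image_of_mem _ hi⟩) p.injective.injOn
  have hdisj : Disjoint (L.image (Fin.castAdd b)) (R.image (Fin.natAdd a)) := by
    simp only [Finset.disjoint_left, Finset.mem_image]
    rintro _ ⟨i, -, rfl⟩ ⟨j, -, hj⟩
    exact hne i j hj.symm
  have hsub : L.image (Fin.castAdd b) ∪ R.image (Fin.natAdd a) ⊆
      J.biUnion fun i => {Fin.castAdd b (p i).1, Fin.natAdd a (p i).2} := by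
    intro x hx
    simp only [L, R, Finset.mem_union, Finset.mem_image, Finset.mem_biUnion, Finset.mem_insert,
      Finset.mem_singleton] at hx ⊢
    grind
  have hU := Finset.card_le_card hsub
  rw [Finset.card_union_of_disjoint hdisj,
    Finset.card_image_of_injective _ (Fin.castAdd_injective a b),
    Finset.card_image_of_injective _ (Fin.natAdd_injective b a)] at hU
  refine le_trans ?_ hU
  by_contra! hlt
  generalize J.card = c at *
  generalize L.card = l at *
  generalize R.card = r at *
  have hl : l ≤ 3 := by omega
  have hr : r ≤ 3 := by omega
  interval_cases l <;> interval_cases r <;> omega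

/-- `n(2,m;1) = C(m,2) = m(m-1)/2` for `m ≥ 3`, and
`n(3,m;1) = ⌊m²/4⌋` for `m ≥ 4`. -/
theorem nMax_k_two_three :
    (∀ m : ℕ, 3 ≤ m →
      nMax 2 m 1 = Nat.choose m 2 ∧ Nat.choose m 2 = m * (m - 1) / 2) ∧
    (∀ m : ℕ, 4 ≤ m → nMax 3 m 1 = m ^ 2 / 4) := by
  refine ⟨fun m _ => ⟨?_, Nat.choose_two_right m⟩, fun m _ => ?_⟩
  · exact IsGreatest.csSup_eq ⟨exists_isRCBC_choose_two m,
      fun n ⟨A, h, hw⟩ => h.le_choose_two le_rfl hw⟩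
  · refine IsGreatest.csSup_eq ⟨?_, fun n ⟨A, h, hw⟩ => h.le_sq_div_four hw⟩
    obtain ⟨q, rfl | rfl⟩ := Nat.even_or_odd' m
    · have : (2 * q) ^ 2 / 4 = q * q := by
        rw [show (2 * q) ^ 2 = 4 * (q * q) by ring]
        omega
      rw [this, two_mul]
      exact exists_isRCBC_mul q q
    · have : (2 * q + 1) ^ 2 / 4 = q * (q + 1) := by
        rw [show (2 * q + 1) ^ 2 = 4 * (q * (q + 1)) + 1 by ring]
        omega
      rw [this, show 2 * q + 1 = q + (q + 1) by ring]
      exact exists_isRCBC_mul q (q + 1)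
end
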